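/- Let χ : ℝ² → ℝ be the radial cutoff defined by χ(x) = 1 for |x| ≤ 2, χ(x) = 1 − (|x|−2)²/8 for 2 ≤ |x| ≤ 4, χ(x) = (|x|−6)²/8 for 4 ≤ |x| ≤ 6, and χ(x) = 0 for |x| ≥ 6. Then 0 ≤ χ ≤ 1, |∇χ| ≤ 1/2 and |Δχ| ≤ 3/8 (wherever defined), and for every x ∈ ℝ² there exists (j,k) ∈ ℤ² such that χ(x − 2√2·(j,k)) = 1; consequently, for every function φ : ℝ² → ℝ, every x ∈ ℝ², and every g : ℝ → ℝ with g(0) = 0, one has |g(φ(x))| ≤ Σ_{(j,k)∈ℤ²} |g(φ^{j,k}(x))|, where φ^{j,k}(x) := χ(x − 2√2·(j,k)) φ(x). -/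

import Mathlib

open MeasureTheory Real Classical
open scoped ENNReal RealInnerProductSpace

noncomputable section

/-- The plane `ℝ²`. -/
abbrev Plane := EuclideanSpace ℝ (Fin 2)

/-- Pointwise norm of the (full) gradient of `u`. -/
def gradNorm (u : Plane → ℝ) (x : Plane) : ℝ := ‖fderiv ℝ u x‖

/-- The `L^p` norm for a real (finite) exponent `p`. -/
def LpNorm (p : ℝ) (u : Plane → ℝ) : ℝ := (∫ x : Plane, |u x| ^ p) ^ (1 / p)

/-- The sup (`L^∞`) norm. -/
def supNorm (u : Plane → ℝ) : ℝ := ⨆ x : Plane, |u x|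

/-- The homogeneous Hölder seminorm `[u]_α`. -/
def holderSemi (α : ℝ) (u : Plane → ℝ) : ℝ :=
  ⨆ p : Plane × Plane,
    if p.1 = p.2 then 0 else |u p.1 - u p.2| / ‖p.1 - p.2‖ ^ α

/-- The Hölder norm `‖u‖_{C^α} = sup |u| + [u]_α`. -/
def holderNorm (α : ℝ) (u : Plane → ℝ) : ℝ := supNorm u + holderSemi α u

/-- `u` is `α`-Hölder continuous. -/
def IsHolder (α : ℝ) (u : Plane → ℝ) : Prop :=
  ∃ C : ℝ, 0 ≤ C ∧ ∀ x y : Plane, |u x - u y| ≤ C * ‖x - y‖ ^ α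

/-- The squared `H¹` norm `‖∇u‖_{L²}² + ‖u‖_{L²}²`. -/
def H1Sq (u : Plane → ℝ) : ℝ :=
  (∫ x : Plane, gradNorm u x ^ 2) + ∫ x : Plane, u x ^ 2

/-- The squared local `H¹` norm `‖u‖_{H¹[R]}²`. -/
def H1locSq (R : ℝ) (u : Plane → ℝ) : ℝ :=
  ⨆ c : Plane, ∫ x in Metric.closedBall c R, (gradNorm u x ^ 2 + u x ^ 2)

/-- Membership in `H¹(ℝ²)` (with classical derivatives). -/
def MemH1 (u : Plane → ℝ) : Prop :=
  Differentiable ℝ u ∧ Integrable (fun x => u x ^ 2) ∧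
    Integrable (fun x => gradNorm u x ^ 2)

/-- The nonlinearity `f(u) = (e^{4π u²} - 1 - 4π u²) u`. -/
def f (s : ℝ) : ℝ := (Real.exp (4 * π * s ^ 2) - 1 - 4 * π * s ^ 2) * s

/-- The potential `F(u) = (1/8π)(e^{4π u²} - 1 - 4π u² - 8π² u⁴)`. -/
def F (s : ℝ) : ℝ :=
  (8 * π)⁻¹ * (Real.exp (4 * π * s ^ 2) - 1 - 4 * π * s ^ 2 - 8 * π ^ 2 * s ^ 4)

/-- The Laplacian of `ψ`, as the sum of pure second partial derivatives. -/
def lap (ψ : Plane → ℝ) (x : Plane) : ℝ :=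
  ∑ i : Fin 2,
    fderiv ℝ (fun y => fderiv ℝ ψ y (EuclideanSpace.single i (1:ℝ))) x
      (EuclideanSpace.single i (1:ℝ))

/-- The radial cutoff function `χ`. -/
def chi (x : Plane) : ℝ :=
  if ‖x‖ ≤ 2 then 1
  else if ‖x‖ ≤ 4 then 1 - (‖x‖ - 2) ^ 2 / 8
  else if ‖x‖ ≤ 6 then (‖x‖ - 6) ^ 2 / 8
  else 0

/-- The lattice point `2√2·(j,k)` of `2√2·ℤ² ⊂ ℝ²`. -/
def latPt (p : ℤ × ℤ) : Plane :=
  (2 * Real.sqrt 2) •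
    ((p.1 : ℝ) • EuclideanSpace.single (0 : Fin 2) (1:ℝ) +
      (p.2 : ℝ) • EuclideanSpace.single (1 : Fin 2) (1:ℝ))

/-- The piece `φ^{j,k}(x) = χ(x - 2√2(j,k)) φ(x)` of the cubic decomposition. -/
def cubicPiece (φ : Plane → ℝ) (p : ℤ × ℤ) (x : Plane) : ℝ := chi (x - latPt p) * φ x

/-- The radial slope of `χ`: `∇χ(x) = chiSlope ‖x‖ • x / ‖x‖`. -/
def chiSlope (r : ℝ) : ℝ := -(max (r - 2) 0) / 4 + max (r - 4) 0 / 2 - max (r - 6) 0 / 4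

lemma chiSlope_of_le_two {r : ℝ} (h : r ≤ 2) : chiSlope r = 0 := by
  rw [chiSlope, max_eq_right, max_eq_right, max_eq_right] <;> linarith

lemma hasDerivAt_max_zero_sq (t : ℝ) :
    HasDerivAt (fun s : ℝ => max s 0 ^ 2) (2 * max t 0) t := by
  rcases lt_trichotomy t 0 with ht | rfl | ht
  · have h : (fun s : ℝ => max s 0 ^ 2) =ᶠ[nhds t] fun _ => 0 := by
      filter_upwards [gt_mem_nhds ht] with s hs
      simp [max_eq_right hs.le]
    simpa [max_eq_right ht.le] using (hasDerivAt_const t (0 : ℝ)).congr_of_eventuallyEq h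
  · rw [hasDerivAt_iff_isLittleO]
    have h : (fun s : ℝ => s ^ 2) =o[nhds 0] fun s : ℝ => s := by
      simpa using Asymptotics.isLittleO_pow_pow (𝕜 := ℝ) (m := 1) (n := 2) one_lt_two
    simp only [max_self, mul_zero, smul_zero, sub_zero, ne_eq, OfNat.ofNat_ne_zero,
      not_false_eq_true, zero_pow]
    refine (Asymptotics.IsBigO.of_bound 1 (Filter.Eventually.of_forall fun s => ?_)).trans_isLittleO h
    rcases le_total s 0 with hs | hs
    · simp [max_eq_right hs, sq_nonneg]
    · simp [max_eq_left hs]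
  · have h : (fun s : ℝ => max s 0 ^ 2) =ᶠ[nhds t] fun s => s ^ 2 := by
      filter_upwards [lt_mem_nhds ht] with s hs
      simp [max_eq_left hs.le]
    simpa [max_eq_left ht.le] using (hasDerivAt_pow 2 t).congr_of_eventuallyEq h

lemma chi_eq_max (x : Plane) :
    chi x = 1 - max (‖x‖ - 2) 0 ^ 2 / 8 + max (‖x‖ - 4) 0 ^ 2 / 4 - max (‖x‖ - 6) 0 ^ 2 / 8 := by
  unfold chi
  split_ifs with h2 h4 h6
  · rw [max_eq_right, max_eq_right, max_eq_right] <;> linarith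
  · rw [max_eq_left, max_eq_right, max_eq_right] <;> linarith
  · rw [max_eq_left, max_eq_left, max_eq_right] <;> linarith
  · rw [max_eq_left, max_eq_left, max_eq_left] <;> linarith

lemma chi_nonneg_le_one (x : Plane) : 0 ≤ chi x ∧ chi x ≤ 1 := by
  unfold chi
  split_ifs <;> constructor <;> nlinarith

lemma hasFDerivAt_norm_of_ne_zero {E : Type*} [NormedAddCommGroup E] [InnerProductSpace ℝ E]
    {x : E} (hx : x ≠ 0) :
    HasFDerivAt (fun y : E => ‖y‖) (‖x‖⁻¹ • innerSL ℝ x) x := by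
  have h := (hasStrictFDerivAt_norm_sq x).hasFDerivAt.sqrt (by simpa using hx)
  simp only [Real.sqrt_sq (norm_nonneg _)] at h
  refine h.congr_fderiv ?_
  ext v
  simp
  field_simp

lemma hasFDerivAt_chi (x : Plane) :
    HasFDerivAt chi ((chiSlope ‖x‖ / ‖x‖) • innerSL ℝ x) x := by
  rcases lt_or_ge ‖x‖ 2 with hx | hx
  · have h : chi =ᶠ[nhds x] fun _ => 1 := by
      filter_upwards [continuous_norm.continuousAt.eventually_lt continuousAt_const hx] with y hy
      simp [chi, hy.le]
    simpa [chiSlope_of_le_two hx.le] using (hasFDerivAt_const (1 : ℝ) x).congr_of_eventuallyEq h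
  · have hx0 : x ≠ 0 := norm_pos_iff.1 (by linarith)
    have hd (a : ℝ) : HasDerivAt (fun r : ℝ => max (r - a) 0 ^ 2) (2 * max (‖x‖ - a) 0) ‖x‖ := by
      simpa using (hasDerivAt_max_zero_sq (‖x‖ - a)).comp_sub_const ‖x‖ a
    have h := (((((hd 2).div_const 8).const_sub 1).add ((hd 4).div_const 4)).sub
      ((hd 6).div_const 8)).comp_hasFDerivAt x (hasFDerivAt_norm_of_ne_zero hx0)
    have he : chi = _ := funext chi_eq_max
    rw [he]
    refine h.congr_fderiv ?_
    rw [smul_smul, chiSlope]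
    congr 1
    ring

lemma abs_chiSlope_le (r : ℝ) : |chiSlope r| ≤ 1 / 2 := by
  unfold chiSlope
  rw [abs_le]
  rcases max_cases (r - 2) 0 with h | h <;> rcases max_cases (r - 4) 0 with h' | h' <;>
    rcases max_cases (r - 6) 0 with h'' | h'' <;> constructor <;> linarith

lemma norm_fderiv_chi_le (x : Plane) : ‖fderiv ℝ chi x‖ ≤ 1 / 2 := by
  rw [(hasFDerivAt_chi x).fderiv, norm_smul, innerSL_apply_norm, norm_div, norm_norm,
    Real.norm_eq_abs]
  rcases eq_or_ne ‖x‖ 0 with h | h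
  · simp [h]
  · rw [div_mul_cancel₀ _ h]
    exact abs_chiSlope_le _

lemma fderiv_chi_single (x : Plane) (i : Fin 2) :
    fderiv ℝ chi x (EuclideanSpace.single i (1 : ℝ)) = chiSlope ‖x‖ / ‖x‖ * x i := by
  rw [(hasFDerivAt_chi x).fderiv]
  simp [EuclideanSpace.inner_single_right]

lemma uniqueDiffWithinAt_closedBall {E : Type*} [NormedAddCommGroup E] [NormedSpace ℝ E]
    {R : ℝ} (hR : 0 < R) {x : E} (hx : ‖x‖ ≤ R) :
    UniqueDiffWithinAt ℝ (Metric.closedBall (0 : E) R) x :=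
  uniqueDiffOn_convex (convex_closedBall _ _)
    ⟨0, Metric.ball_subset_interior_closedBall (Metric.mem_ball_self hR)⟩ x (by simpa using hx)

lemma fderiv_eq_of_eventuallyEq_nhdsWithin {E G : Type*} [NormedAddCommGroup E] [NormedSpace ℝ E]
    [NormedAddCommGroup G] [NormedSpace ℝ G] {u v : E → G} {s : Set E} {x : E} {D : E →L[ℝ] G}
    (hu : DifferentiableAt ℝ u x) (hv : HasFDerivWithinAt v D s x)
    (hs : UniqueDiffWithinAt ℝ s x) (hx : x ∈ s) (h : u =ᶠ[nhdsWithin x s] v) :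
    fderiv ℝ u x = D :=
  hs.eq hu.hasFDerivAt.hasFDerivWithinAt
    (hv.congr_of_eventuallyEq h (h.self_of_nhdsWithin hx))

/-- If the slope of `χ` is affine near `‖x‖` inside a set `s`, then `Δχ(x)` is determined by
that affine function, even when `x` is on the boundary of `s`. -/
lemma lap_chi_of_slope_eq {x : Plane} {s : Set Plane} {a b : ℝ}
    (hd : ∀ i : Fin 2,
      DifferentiableAt ℝ (fun y => fderiv ℝ chi y (EuclideanSpace.single i (1 : ℝ))) x)
    (hx0 : x ≠ 0) (hs : UniqueDiffWithinAt ℝ s x) (hx : x ∈ s)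
    (h : ∀ᶠ y in nhdsWithin x s, chiSlope ‖y‖ = a + b * ‖y‖) :
    lap chi x = a / ‖x‖ + 2 * b := by
  have hr : ‖x‖ ≠ 0 := norm_ne_zero_iff.2 hx0
  have hpart (i : Fin 2) :
      fderiv ℝ (fun y => fderiv ℝ chi y (EuclideanSpace.single i (1 : ℝ))) x
        (EuclideanSpace.single i (1 : ℝ)) = a / ‖x‖ + b - a * x i ^ 2 / ‖x‖ ^ 3 := by
    have hcoord : HasFDerivAt (fun y : Plane => y i) (EuclideanSpace.proj i : Plane →L[ℝ] ℝ) x :=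
      (EuclideanSpace.proj i : Plane →L[ℝ] ℝ).hasFDerivAt
    have hinv := (hasDerivAt_inv hr).comp_hasFDerivAt x (hasFDerivAt_norm_of_ne_zero hx0)
    have hP := ((hinv.const_mul a).add_const b).mul hcoord
    have heq : (fun y => fderiv ℝ chi y (EuclideanSpace.single i (1 : ℝ)))
        =ᶠ[nhdsWithin x s] fun y : Plane => (a * ‖y‖⁻¹ + b) * y i := by
      filter_upwards [h, nhdsWithin_le_nhds (isOpen_ne.mem_nhds hx0)] with y hy hy0
      have : ‖y‖ ≠ 0 := norm_ne_zero_iff.2 hy0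
      rw [fderiv_chi_single, hy]
      field_simp
    rw [fderiv_eq_of_eventuallyEq_nhdsWithin (hd i) hP.hasFDerivWithinAt hs hx heq]
    simp [EuclideanSpace.inner_single_right]
    field_simp
    ring
  have hsq : x 0 ^ 2 + x 1 ^ 2 = ‖x‖ ^ 2 := by
    simp [EuclideanSpace.norm_sq_eq, Fin.sum_univ_two]
  rw [lap, Fin.sum_univ_two, hpart, hpart]
  field_simp
  linear_combination (-a) * hsq

lemma chiSlope_of_two_le_of_le_four {r : ℝ} (h : 2 ≤ r) (h' : r ≤ 4) :
    chiSlope r = 1 / 2 + -1 / 4 * r := by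
  rw [chiSlope, max_eq_left, max_eq_right, max_eq_right] <;> linarith

lemma chiSlope_of_four_le_of_le_six {r : ℝ} (h : 4 ≤ r) (h' : r ≤ 6) :
    chiSlope r = -3 / 2 + 1 / 4 * r := by
  rw [chiSlope, max_eq_left, max_eq_left, max_eq_right] <;> linarith

lemma chiSlope_of_six_le {r : ℝ} (h : 6 ≤ r) : chiSlope r = 0 := by
  rw [chiSlope, max_eq_left, max_eq_left, max_eq_left] <;> linarith

lemma abs_lap_chi_le {x : Plane}
    (hd : ∀ i : Fin 2,
      DifferentiableAt ℝ (fun y => fderiv ℝ chi y (EuclideanSpace.single i (1 : ℝ))) x) :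
    |lap chi x| ≤ 3 / 8 := by
  have hnear {r : ℝ} (hr : r < ‖x‖) (s : Set Plane) : ∀ᶠ y in nhdsWithin x s, r < ‖y‖ :=
    nhdsWithin_le_nhds (continuousAt_const.eventually_lt continuous_norm.continuousAt hr)
  rcases le_or_gt ‖x‖ 2 with h2 | h2
  · have hpart (i : Fin 2) :
        fderiv ℝ (fun y => fderiv ℝ chi y (EuclideanSpace.single i (1 : ℝ))) x = 0 := by
      refine fderiv_eq_of_eventuallyEq_nhdsWithin (v := fun _ => 0) (hd i)
        (hasFDerivWithinAt_const _ _ _) (uniqueDiffWithinAt_closedBall two_pos h2)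
        (by simpa using h2) ?_
      filter_upwards [self_mem_nhdsWithin] with y hy
      rw [fderiv_chi_single, chiSlope_of_le_two (by simpa using hy)]
      simp
    simp only [lap, hpart]
    norm_num
  have hx0 : x ≠ 0 := norm_pos_iff.1 (by linarith)
  rcases le_or_gt ‖x‖ 4 with h4 | h4
  · rw [lap_chi_of_slope_eq (a := 1 / 2) (b := -1 / 4) hd hx0
      (uniqueDiffWithinAt_closedBall four_pos h4) (by simpa using h4) ?_]
    · have h1 : 1 / 2 / ‖x‖ ≤ 1 / 4 := by rw [div_le_iff₀] <;> linarith
      have h3 : 1 / 8 ≤ 1 / 2 / ‖x‖ := by rw [le_div_iff₀] <;> linarith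
      rw [abs_le]
      constructor <;> linarith
    · filter_upwards [self_mem_nhdsWithin, hnear h2 _] with y hy hy'
      exact chiSlope_of_two_le_of_le_four hy'.le (by simpa using hy)
  rcases le_or_gt ‖x‖ 6 with h6 | h6
  · rw [lap_chi_of_slope_eq (a := -3 / 2) (b := 1 / 4) hd hx0
      (uniqueDiffWithinAt_closedBall (by norm_num) h6) (by simpa using h6) ?_]
    · have h1 : -3 / 2 / ‖x‖ ≤ -1 / 4 := by rw [div_le_iff₀] <;> linarith
      have h3 : -3 / 8 ≤ -3 / 2 / ‖x‖ := by rw [le_div_iff₀] <;> linarith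
      rw [abs_le]
      constructor <;> linarith
    · filter_upwards [self_mem_nhdsWithin, hnear h4 _] with y hy hy'
      exact chiSlope_of_four_le_of_le_six hy'.le (by simpa using hy)
  · rw [lap_chi_of_slope_eq (a := 0) (b := 0) hd hx0 uniqueDiffWithinAt_univ (Set.mem_univ x) ?_]
    · norm_num
    · filter_upwards [hnear h6 _] with y hy
      simpa using chiSlope_of_six_le hy.le

lemma latPt_apply_zero (p : ℤ × ℤ) : latPt p 0 = 2 * √2 * p.1 := by
  simp [latPt]

lemma latPt_apply_one (p : ℤ × ℤ) : latPt p 1 = 2 * √2 * p.2 := by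
  simp [latPt]

lemma exists_chi_sub_latPt_eq_one (x : Plane) : ∃ p : ℤ × ℤ, chi (x - latPt p) = 1 := by
  have hround (t : ℝ) : (t - 2 * √2 * round (t / (2 * √2))) ^ 2 ≤ 2 := by
    have h := sq_le_sq' (abs_le.1 (abs_sub_round (t / (2 * √2)))).1
      (abs_le.1 (abs_sub_round (t / (2 * √2)))).2
    have h8 : (2 * √2) ^ 2 = 8 := by rw [mul_pow, Real.sq_sqrt zero_le_two]; norm_num
    have he : t - 2 * √2 * round (t / (2 * √2)) =
        2 * √2 * (t / (2 * √2) - round (t / (2 * √2))) := by field_simp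
    rw [he, mul_pow, h8]
    linarith
  refine ⟨(round (x 0 / (2 * √2)), round (x 1 / (2 * √2))), if_pos ?_⟩
  refine abs_le_of_sq_le_sq' ?_ zero_le_two |>.2
  rw [EuclideanSpace.norm_sq_eq, Fin.sum_univ_two]
  simp only [PiLp.sub_apply, latPt_apply_zero, latPt_apply_one, Real.norm_eq_abs, sq_abs]
  linarith [hround (x 0), hround (x 1)]

lemma chi_eq_zero_of_six_le {x : Plane} (h : 6 ≤ ‖x‖) : chi x = 0 := by
  rw [chi_eq_max, max_eq_left, max_eq_left, max_eq_left] <;> linarith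

lemma finite_support_chi_sub_latPt (x : Plane) :
    (Function.support fun p : ℤ × ℤ => chi (x - latPt p)).Finite := by
  have hmem {t : ℝ} {n : ℤ} (h : |t - 2 * √2 * n| < 6) :
      n ∈ Set.Icc ⌊(t - 6) / (2 * √2)⌋ ⌈(t + 6) / (2 * √2)⌉ := by
    rw [abs_lt] at h
    have h0 : 0 < 2 * √2 := by positivity
    constructor
    · rw [Int.floor_le_iff, div_lt_iff₀ h0]
      nlinarith
    · rw [Int.le_ceil_iff, lt_div_iff₀ h0]
      nlinarith
  refine ((Set.finite_Icc ⌊(x 0 - 6) / (2 * √2)⌋ ⌈(x 0 + 6) / (2 * √2)⌉).prod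
    (Set.finite_Icc ⌊(x 1 - 6) / (2 * √2)⌋ ⌈(x 1 + 6) / (2 * √2)⌉)).subset fun p hp => ?_
  have hn : ‖x - latPt p‖ < 6 := lt_of_not_ge fun h => hp (chi_eq_zero_of_six_le h)
  have h0 := (PiLp.norm_apply_le (x - latPt p) 0).trans_lt hn
  have h1 := (PiLp.norm_apply_le (x - latPt p) 1).trans_lt hn
  rw [PiLp.sub_apply, latPt_apply_zero] at h0
  rw [PiLp.sub_apply, latPt_apply_one] at h1
  exact ⟨hmem h0, hmem h1⟩

lemma abs_comp_le_tsum_cubicPiece (φ : Plane → ℝ) {g : ℝ → ℝ} (hg : g 0 = 0) (x : Plane) :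
    |g (φ x)| ≤ ∑' p : ℤ × ℤ, |g (cubicPiece φ p x)| := by
  have hsum : Summable fun p : ℤ × ℤ => |g (cubicPiece φ p x)| := by
    refine summable_of_hasFiniteSupport ((finite_support_chi_sub_latPt x).subset fun p hp h => hp ?_)
    simp only at h
    simp [cubicPiece, h, hg]
  obtain ⟨p, hp⟩ := exists_chi_sub_latPt_eq_one x
  simpa [cubicPiece, hp] using hsum.le_tsum p fun _ _ => abs_nonneg _

/-- properties of the cutoff `χ` and the cubic decomposition. -/
theorem statement9 :
    (∀ x : Plane, 0 ≤ chi x ∧ chi x ≤ 1) ∧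
    (∀ x : Plane, DifferentiableAt ℝ chi x → ‖fderiv ℝ chi x‖ ≤ 1/2) ∧
    (∀ x : Plane,
      (∀ i : Fin 2,
        DifferentiableAt ℝ
          (fun y => fderiv ℝ chi y (EuclideanSpace.single i (1:ℝ))) x) →
      |lap chi x| ≤ 3/8) ∧
    (∀ x : Plane, ∃ p : ℤ × ℤ, chi (x - latPt p) = 1) ∧
    (∀ (φ : Plane → ℝ) (g : ℝ → ℝ), g 0 = 0 → ∀ x : Plane,
      |g (φ x)| ≤ ∑' p : ℤ × ℤ, |g (cubicPiece φ p x)|) := by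
  exact ⟨chi_nonneg_le_one, fun x _ => norm_fderiv_chi_le x, fun _ => abs_lap_chi_le,
    exists_chi_sub_latPt_eq_one, fun φ _ hg x => abs_comp_le_tsum_cubicPiece φ hg x⟩
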